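/- Consider a k-stage screening process with minimally effective tests, and let α ∈ [0,1]. For an Equal Opportunity policy π with positive precision denominator, define f_α(π) = (1−α)·recall(π) + α·precision(π). Let π_bypass be the policy with all entries equal to 1 (which satisfies Equal Opportunity with recall 1) and let π* be the Opportunity Ratio policy. Then for every Equal Opportunity policy π with positive precision denominator, f_α(π) ≤ 2·max(f_α(π_bypass), f_α(π*)). (The better of bypassing all tests and the Opportunity Ratio policy is a 2-approximation of the optimum of f_α over Equal Opportunity policies.) -/

import Mathlib

open Finset

/-- Promotion probability of a positive example: `M(τ,π) = τ₁π₁ + (1−τ₁)π₀`. -/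
noncomputable def Mval (t p : ℝ × ℝ) : ℝ := t.1 * p.1 + (1 - t.1) * p.2

/-- Promotion probability of a negative example: `N(τ,π) = τ₀π₁ + (1−τ₀)π₀`. -/
noncomputable def Nval (t p : ℝ × ℝ) : ℝ := t.2 * p.1 + (1 - t.2) * p.2

/-- True positive rate of group `x` through a `k`-stage pipeline. -/
noncomputable def MX {𝒳 : Type*} {k : ℕ} (τ π : 𝒳 → Fin k → ℝ × ℝ) (x : 𝒳) : ℝ :=
  ∏ i, Mval (τ x i) (π x i)

/-- False positive rate of group `x` through a `k`-stage pipeline. -/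
noncomputable def NX {𝒳 : Type*} {k : ℕ} (τ π : 𝒳 → Fin k → ℝ × ℝ) (x : 𝒳) : ℝ :=
  ∏ i, Nval (τ x i) (π x i)

/-- Precision (interview efficiency) of a policy. -/
noncomputable def prec {𝒳 : Type*} [Fintype 𝒳] {k : ℕ} (q u : 𝒳 → ℝ)
    (τ π : 𝒳 → Fin k → ℝ × ℝ) : ℝ :=
  (∑ x, q x * MX τ π x) / ((∑ x, q x * MX τ π x) + ∑ x, u x * NX τ π x)

/-- A policy has all its entries in `[0,1]`. -/
def IsPolicy {𝒳 : Type*} {k : ℕ} (π : 𝒳 → Fin k → ℝ × ℝ) : Prop :=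
  ∀ x i, (π x i).1 ∈ Set.Icc (0:ℝ) 1 ∧ (π x i).2 ∈ Set.Icc (0:ℝ) 1

/-- All tests are minimally effective: `τ₁ > τ₀ ≥ 0` (and lie in `[0,1]²`). -/
def MinEff {𝒳 : Type*} {k : ℕ} (τ : 𝒳 → Fin k → ℝ × ℝ) : Prop :=
  ∀ x i, (τ x i).2 < (τ x i).1 ∧ 0 ≤ (τ x i).2 ∧ (τ x i).1 ≤ 1

theorem MinEff.fst_pos {𝒳 : Type*} {k : ℕ} {τ : 𝒳 → Fin k → ℝ × ℝ} (hτ : MinEff τ)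
    (x : 𝒳) (i : Fin k) : 0 < (τ x i).1 :=
  (hτ x i).2.1.trans_lt (hτ x i).1

theorem Mval_nonneg {t p : ℝ × ℝ} (h0 : 0 ≤ t.1) (h1 : t.1 ≤ 1) (hp1 : 0 ≤ p.1)
    (hp0 : 0 ≤ p.2) : 0 ≤ Mval t p :=
  add_nonneg (mul_nonneg h0 hp1) (mul_nonneg (sub_nonneg.2 h1) hp0)

theorem Mval_le_one {t p : ℝ × ℝ} (h0 : 0 ≤ t.1) (h1 : t.1 ≤ 1) (hp1 : p.1 ≤ 1)
    (hp0 : p.2 ≤ 1) : Mval t p ≤ 1 := by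
  unfold Mval
  nlinarith [mul_le_mul_of_nonneg_left hp1 h0,
    mul_le_mul_of_nonneg_left hp0 (sub_nonneg.2 h1)]

/-- A single test lets negatives through at a rate at least `τ₀/τ₁` times that of positives. -/
theorem Mval_mul_le_Nval {t p : ℝ × ℝ} (h : t.2 ≤ t.1) (h1 : 0 < t.1) (hp0 : 0 ≤ p.2) :
    Mval t p * (t.2 / t.1) ≤ Nval t p := by
  rw [← mul_div_assoc, div_le_iff₀ h1]
  unfold Mval Nval
  nlinarith [mul_nonneg hp0 (sub_nonneg.2 h)]

section Pipeline

variable {𝒳 : Type*} {k : ℕ} {τ π : 𝒳 → Fin k → ℝ × ℝ}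

theorem MX_nonneg (hτ : MinEff τ) (hπ : IsPolicy π) (x : 𝒳) : 0 ≤ MX τ π x :=
  prod_nonneg fun i _ => Mval_nonneg (hτ.fst_pos x i).le (hτ x i).2.2 (hπ x i).1.1 (hπ x i).2.1

theorem MX_le_one (hτ : MinEff τ) (hπ : IsPolicy π) (x : 𝒳) : MX τ π x ≤ 1 :=
  prod_le_one
    (fun i _ => Mval_nonneg (hτ.fst_pos x i).le (hτ x i).2.2 (hπ x i).1.1 (hπ x i).2.1)
    fun i _ => Mval_le_one (hτ.fst_pos x i).le (hτ x i).2.2 (hπ x i).1.2 (hπ x i).2.2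

theorem MX_mul_prod_le_NX (hτ : MinEff τ) (hπ : IsPolicy π) (x : 𝒳) :
    MX τ π x * ∏ i, ((τ x i).2 / (τ x i).1) ≤ NX τ π x := by
  unfold MX NX
  rw [← prod_mul_distrib]
  refine prod_le_prod (fun i _ => mul_nonneg ?_ ?_) fun i _ =>
    Mval_mul_le_Nval (hτ x i).1.le (hτ.fst_pos x i) (hπ x i).2.1
  · exact Mval_nonneg (hτ.fst_pos x i).le (hτ x i).2.2 (hπ x i).1.1 (hπ x i).2.1
  · exact div_nonneg (hτ x i).2.1 (hτ.fst_pos x i).le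

/-- True positive rate of a policy that randomizes the positives of one stage only. -/
theorem MX_single_stage (i₀ : Fin k) (c : 𝒳 → ℝ) (x : 𝒳) :
    MX τ (fun x i => if i = i₀ then (c x, (0 : ℝ)) else (1, 0)) x =
      (∏ i, (τ x i).1) * c x := by
  have h (i : Fin k) : Mval (τ x i) (if i = i₀ then (c x, (0 : ℝ)) else (1, 0)) =
      (τ x i).1 * if i = i₀ then c x else 1 := by
    split_ifs <;> simp [Mval]
  simp only [MX, h, prod_mul_distrib]
  simp

/-- False positive rate of a policy that randomizes the positives of one stage only. -/
theorem NX_single_stage (i₀ : Fin k) (c : 𝒳 → ℝ) (x : 𝒳) :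
    NX τ (fun x i => if i = i₀ then (c x, (0 : ℝ)) else (1, 0)) x =
      (∏ i, (τ x i).2) * c x := by
  have h (i : Fin k) : Nval (τ x i) (if i = i₀ then (c x, (0 : ℝ)) else (1, 0)) =
      (τ x i).2 * if i = i₀ then c x else 1 := by
    split_ifs <;> simp [Nval]
  simp only [NX, h, prod_mul_distrib]
  simp

theorem prec_nonneg [Fintype 𝒳] {q u : 𝒳 → ℝ} (hq : ∀ x, 0 ≤ q x) (hu : ∀ x, 0 ≤ u x)
    (hM : ∀ x, 0 ≤ MX τ π x) (hN : ∀ x, 0 ≤ NX τ π x) : 0 ≤ prec q u τ π := by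
  have hQ : 0 ≤ ∑ x, q x * MX τ π x := sum_nonneg fun x _ => mul_nonneg (hq x) (hM x)
  have hU : 0 ≤ ∑ x, u x * NX τ π x := sum_nonneg fun x _ => mul_nonneg (hu x) (hN x)
  exact div_nonneg hQ (add_nonneg hQ hU)

/-- The Opportunity Ratio policy maximizes precision over Equal Opportunity policies. -/
theorem prec_le_prec_opportunityRatio [Fintype 𝒳] [Nonempty 𝒳] {q u : 𝒳 → ℝ}
    (hq : ∀ x, 0 < q x) (hu : ∀ x, 0 < u x) (hτ : MinEff τ) (hπ : IsPolicy π) {r R : ℝ}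
    (hr : ∀ x, MX τ π x = r) (hR : 0 < R) (i₀ : Fin k)
    (hden : 0 < (∑ x, q x * MX τ π x) + ∑ x, u x * NX τ π x) :
    prec q u τ π ≤ prec q u τ
      (fun x i => if i = i₀ then (R / ∏ j, (τ x j).1, (0 : ℝ)) else (1, 0)) := by
  have hP (x : 𝒳) : 0 < ∏ j, (τ x j).1 := prod_pos fun i _ => hτ.fst_pos x i
  have hr0 : 0 ≤ r := by
    obtain ⟨x⟩ := ‹Nonempty 𝒳›
    exact hr x ▸ MX_nonneg hτ hπ x
  have hM (x : 𝒳) : (∏ i, (τ x i).1) * (R / ∏ j, (τ x j).1) = R :=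
    mul_div_cancel₀ R (hP x).ne'
  have hN (x : 𝒳) : (∏ i, (τ x i).2) * (R / ∏ j, (τ x j).1) =
      (∏ i, ((τ x i).2 / (τ x i).1)) * R := by
    rw [prod_div_distrib]; ring
  have hQ : 0 < ∑ x, q x := sum_pos (fun x _ => hq x) univ_nonempty
  have hU : 0 ≤ ∑ x, u x * ∏ i, ((τ x i).2 / (τ x i).1) :=
    sum_nonneg fun x _ => mul_nonneg (hu x).le
      (prod_nonneg fun i _ => div_nonneg (hτ x i).2.1 (hτ.fst_pos x i).le)
  have hS : (∑ x, u x * ∏ i, ((τ x i).2 / (τ x i).1)) * r ≤ ∑ x, u x * NX τ π x := by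
    rw [sum_mul]
    refine sum_le_sum fun x _ => ?_
    have := mul_le_mul_of_nonneg_left (MX_mul_prod_le_NX hτ hπ x) (hu x).le
    rw [hr x] at this
    linarith
  unfold prec
  simp only [MX_single_stage i₀ (fun x => R / ∏ j, (τ x j).1),
    NX_single_stage i₀ (fun x => R / ∏ j, (τ x j).1), hM, hN]
  simp only [hr, ← mul_assoc, ← sum_mul] at hden ⊢
  have hden' : 0 < (∑ x, q x) * R + (∑ x, u x * ∏ i, ((τ x i).2 / (τ x i).1)) * R :=
    add_pos_of_pos_of_nonneg (mul_pos hQ hR) (mul_nonneg hU hR.le)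
  rw [div_le_div_iff₀ hden hden']
  nlinarith [mul_le_mul_of_nonneg_left hS (mul_pos hQ hR).le]

end Pipeline

/-- The better of the "bypass all tests" policy and the Opportunity Ratio policy is a
2-approximation for maximizing `f_α = (1−α)·recall + α·precision` over Equal Opportunity
policies. -/
theorem stmt6 {𝒳 : Type*} [Fintype 𝒳] [Nonempty 𝒳] {k : ℕ} (hk : 0 < k)
    (q u : 𝒳 → ℝ) (τ : 𝒳 → Fin k → ℝ × ℝ)
    (hq : ∀ x, 0 < q x) (hu : ∀ x, 0 < u x) (hτ : MinEff τ)
    (α : ℝ) (hα : α ∈ Set.Icc (0:ℝ) 1)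
    (Xstar : 𝒳) (hXstar : ∀ x, (∏ i, (τ Xstar i).1) ≤ ∏ i, (τ x i).1)
    (πbypass πstar : 𝒳 → Fin k → ℝ × ℝ)
    (hbypass : πbypass = fun _ _ => ((1:ℝ), (1:ℝ)))
    (hπstar : πstar = fun x i =>
      if i = (⟨0, hk⟩ : Fin k) then ((∏ j, (τ Xstar j).1) / ∏ j, (τ x j).1, (0:ℝ))
      else (1, 0)) :
    ∀ (π : 𝒳 → Fin k → ℝ × ℝ) (r : ℝ), IsPolicy π → (∀ x, MX τ π x = r) →
      0 < (∑ x, q x * MX τ π x) + ∑ x, u x * NX τ π x →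
      (1 - α) * r + α * prec q u τ π ≤
        2 * max ((1 - α) * 1 + α * prec q u τ πbypass)
            ((1 - α) * (∏ i, (τ Xstar i).1) + α * prec q u τ πstar) := by
  subst hbypass hπstar
  intro π r hπ hr hden
  obtain ⟨hα0, hα1⟩ := hα
  have hR : 0 < ∏ i, (τ Xstar i).1 := prod_pos fun i _ => hτ.fst_pos Xstar i
  have hr1 : r ≤ 1 := hr Xstar ▸ MX_le_one hτ hπ Xstar
  have hprec := mul_le_mul_of_nonneg_left
    (prec_le_prec_opportunityRatio hq hu hτ hπ hr hR ⟨0, hk⟩ hden) hα0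
  have hbypass : 0 ≤ α * prec q u τ (fun _ _ => ((1 : ℝ), (1 : ℝ))) :=
    mul_nonneg hα0 (prec_nonneg (fun x => (hq x).le) (fun x => (hu x).le)
      (by simp [MX, Mval]) (by simp [NX, Nval]))
  have hrecall : (1 - α) * r ≤ (1 - α) * 1 :=
    mul_le_mul_of_nonneg_left hr1 (sub_nonneg.2 hα1)
  have hstar : 0 ≤ (1 - α) * ∏ i, (τ Xstar i).1 := mul_nonneg (sub_nonneg.2 hα1) hR.le
  rw [two_mul]
  exact add_le_add
    ((hrecall.trans (le_add_of_nonneg_right hbypass)).trans (le_max_left _ _))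
    ((hprec.trans (le_add_of_nonneg_left hstar)).trans (le_max_right _ _))
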